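/- Let G be a finite abelian group of rank at most 2, i.e. G is isomorphic as a group to (ℤ/n₁ℤ) × (ℤ/n₂ℤ) for some positive integers n₁, n₂. Let ℓ be a prime and let d, e, k be natural numbers with 1 ≤ k and d + k + 1 ≤ e. Suppose that there exists an injective group homomorphism (ℤ/ℓ^dℤ) × (ℤ/ℓ^dℤ) → G and that the ℓ-adic valuation of the order of G equals d + e + k − 1 (i.e. ℓ^{d+e+k−1} divides |G| but ℓ^{d+e+k} does not). Then there exists an injective group homomorphism (ℤ/ℓ^eℤ) × (ℤ/ℓ^dℤ) → G if and only if there exists no injective group homomorphism (ℤ/ℓ^{d+k}ℤ) × (ℤ/ℓ^{d+k}ℤ) → G. -/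

import Mathlib

lemma AddEquiv.exists_injective_addMonoidHom_congr {A G H : Type*} [AddZeroClass A]
    [AddZeroClass G] [AddZeroClass H] (φ : G ≃+ H) :
    (∃ f : A →+ G, Function.Injective f) ↔ ∃ f : A →+ H, Function.Injective f :=
  ⟨fun ⟨f, hf⟩ ↦ ⟨φ.toAddMonoidHom.comp f, φ.injective.comp hf⟩,
    fun ⟨f, hf⟩ ↦ ⟨φ.symm.toAddMonoidHom.comp f, φ.symm.injective.comp hf⟩⟩

lemma ZMod.exists_injective_addMonoidHom_of_dvd {m n : ℕ} (hn : 0 < n) (h : m ∣ n) :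
    ∃ f : ZMod m →+ ZMod n, Function.Injective f := by
  obtain ⟨c, rfl⟩ := h
  have hc : (c : ℤ) ≠ 0 := by
    rintro hc
    simp_all
  refine ⟨ZMod.lift m ⟨zmultiplesHom _ (c : ZMod (m * c)), ?_⟩, ?_⟩
  · simp [← Nat.cast_mul]
  · rw [ZMod.lift_injective]
    intro a ha
    have ha' : ((a * c : ℤ) : ZMod (m * c)) = 0 := by simpa using ha
    rw [ZMod.intCast_zmod_eq_zero_iff_dvd, Nat.cast_mul] at ha'
    rw [ZMod.intCast_zmod_eq_zero_iff_dvd]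
    exact (mul_dvd_mul_iff_right hc).1 ha'

lemma IsAddCyclic.card_dvd_of_forall_nsmul_eq_zero {H : Type*} [AddGroup H] [IsAddCyclic H]
    {m : ℕ} (h : ∀ x : H, m • x = 0) : Nat.card H ∣ m := by
  rw [← IsAddCyclic.exponent_eq_card]
  exact AddMonoid.exponent_dvd_of_forall_nsmul_eq_zero h

lemma ZMod.nsmul_prod_self_eq_zero {m : ℕ} (x : ZMod m × ZMod m) : m • x = 0 := by
  ext <;> simp

lemma ZMod.dvd_snd_of_injective_prod {m n₁ n₂ : ℕ} (hm : 0 < m)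
    (f : ZMod m × ZMod m →+ ZMod n₁ × ZMod n₂) (hf : Function.Injective f) : m ∣ n₂ := by
  have : NeZero m := ⟨hm.ne'⟩
  set g := (AddMonoidHom.fst _ _).comp f
  set h := ((AddMonoidHom.snd _ _).comp f).comp g.ker.subtype
  have hinj : Function.Injective h := by
    rintro ⟨x, hx⟩ ⟨y, hy⟩ hxy
    exact Subtype.ext (hf (Prod.ext (Eq.trans hx (Eq.symm hy)) hxy))
  have hcyc : IsAddCyclic g.ker := isAddCyclic_of_injective h hinj
  have hker : Nat.card g.ker ∣ m := IsAddCyclic.card_dvd_of_forall_nsmul_eq_zero fun x ↦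
    Subtype.ext (ZMod.nsmul_prod_self_eq_zero x.1)
  have hrange : Nat.card g.range ∣ m := IsAddCyclic.card_dvd_of_forall_nsmul_eq_zero <| by
    rintro ⟨_, x, rfl⟩
    refine Subtype.ext ?_
    change m • g x = 0
    rw [← map_nsmul, ZMod.nsmul_prod_self_eq_zero, map_zero]
  have hmul : Nat.card g.ker * Nat.card g.range = m * m := by
    rw [← AddSubgroup.index_ker, AddSubgroup.card_mul_index, Nat.card_prod, Nat.card_zmod]
  have hcard : Nat.card g.ker = m := by
    have h₁ := Nat.le_of_dvd hm hker
    have h₂ := Nat.le_of_dvd hm hrange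
    nlinarith
  have hdvd := AddSubgroup.card_dvd_of_injective h hinj
  rwa [hcard, Nat.card_zmod] at hdvd

lemma ZMod.dvd_of_injective_prod {m n₁ n₂ : ℕ} (hm : 0 < m)
    (f : ZMod m × ZMod m →+ ZMod n₁ × ZMod n₂) (hf : Function.Injective f) :
    m ∣ n₁ ∧ m ∣ n₂ := by
  obtain ⟨g, hg⟩ := AddEquiv.prodComm.exists_injective_addMonoidHom_congr.1 ⟨f, hf⟩
  exact ⟨dvd_snd_of_injective_prod hm g hg, dvd_snd_of_injective_prod hm f hf⟩

lemma ZMod.exists_injective_prod_of_dvd {m₁ m₂ n₁ n₂ : ℕ} (hn₁ : 0 < n₁) (hn₂ : 0 < n₂)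
    (h₁ : m₁ ∣ n₁) (h₂ : m₂ ∣ n₂) :
    ∃ f : ZMod m₁ × ZMod m₂ →+ ZMod n₁ × ZMod n₂, Function.Injective f := by
  obtain ⟨f, hf⟩ := exists_injective_addMonoidHom_of_dvd hn₁ h₁
  obtain ⟨g, hg⟩ := exists_injective_addMonoidHom_of_dvd hn₂ h₂
  exact ⟨f.prodMap g, hf.prodMap hg⟩

lemma ZMod.prime_pow_dvd_or_dvd_of_injective {p : ℕ} (hp : p.Prime) {i n₁ n₂ : ℕ}
    (f : ZMod (p ^ i) →+ ZMod n₁ × ZMod n₂) (hf : Function.Injective f) :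
    p ^ i ∣ n₁ ∨ p ^ i ∣ n₂ := by
  have hord : addOrderOf (f 1) = p ^ i := by
    rw [addOrderOf_injective f hf, ZMod.addOrderOf_one]
  have h₁ : addOrderOf (f 1).1 ∣ n₁ := addOrderOf_dvd_of_nsmul_eq_zero (by simp)
  have h₂ : addOrderOf (f 1).2 ∣ n₂ := addOrderOf_dvd_of_nsmul_eq_zero (by simp)
  rw [Prod.addOrderOf] at hord
  obtain ⟨a, -, ha⟩ := (Nat.dvd_prime_pow hp).1 (hord ▸ Nat.dvd_lcm_left _ _)
  obtain ⟨b, -, hb⟩ := (Nat.dvd_prime_pow hp).1 (hord ▸ Nat.dvd_lcm_right _ _)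
  rw [ha, hb] at hord
  rw [ha] at h₁
  rw [hb] at h₂
  rcases le_total a b with hab | hab
  · rw [Nat.lcm_eq_right (pow_dvd_pow p hab)] at hord
    exact .inr (hord ▸ h₂)
  · rw [Nat.lcm_eq_left (pow_dvd_pow p hab)] at hord
    exact .inl (hord ▸ h₁)

theorem embed_iff_not_embed (G : Type*) [AddCommGroup G] [Finite G]
    (hrank : ∃ n₁ n₂ : ℕ, 0 < n₁ ∧ 0 < n₂ ∧ Nonempty (G ≃+ (ZMod n₁ × ZMod n₂)))
    (ℓ : ℕ) (hℓ : ℓ.Prime) (d e k : ℕ) (hk : 1 ≤ k) (hde : d + k + 1 ≤ e)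
    (hembed : ∃ f : (ZMod (ℓ ^ d) × ZMod (ℓ ^ d)) →+ G, Function.Injective f)
    (hval : ℓ ^ (d + e + k - 1) ∣ Nat.card G ∧ ¬ ℓ ^ (d + e + k) ∣ Nat.card G) :
    (∃ f : (ZMod (ℓ ^ e) × ZMod (ℓ ^ d)) →+ G, Function.Injective f) ↔
      ¬ ∃ f : (ZMod (ℓ ^ (d + k)) × ZMod (ℓ ^ (d + k))) →+ G, Function.Injective f := by
  obtain ⟨n₁, n₂, hn₁, hn₂, ⟨φ⟩⟩ := hrank
  rw [φ.exists_injective_addMonoidHom_congr] at hembed ⊢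
  rw [φ.exists_injective_addMonoidHom_congr]
  rw [Nat.card_congr φ.toEquiv, Nat.card_prod, Nat.card_zmod, Nat.card_zmod,
    hℓ.pow_dvd_iff_le_factorization (by positivity),
    hℓ.pow_dvd_iff_le_factorization (by positivity),
    Nat.factorization_mul hn₁.ne' hn₂.ne', Finsupp.add_apply] at hval
  obtain ⟨f, hf⟩ := hembed
  obtain ⟨hd₁, hd₂⟩ := ZMod.dvd_of_injective_prod (pow_pos hℓ.pos d) f hf
  have key₁ (i : ℕ) := hℓ.pow_dvd_iff_le_factorization (k := i) hn₁.ne'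
  have key₂ (i : ℕ) := hℓ.pow_dvd_iff_le_factorization (k := i) hn₂.ne'
  constructor
  · rintro ⟨g, hg⟩ ⟨g', hg'⟩
    obtain ⟨h₁, h₂⟩ := ZMod.dvd_of_injective_prod (pow_pos hℓ.pos _) g' hg'
    have h := ZMod.prime_pow_dvd_or_dvd_of_injective hℓ (g.comp (AddMonoidHom.inl _ _))
      (hg.comp (Prod.mk_left_injective 0))
    rw [key₁] at h h₁
    rw [key₂] at h h₂
    omega
  · intro hno
    by_cases h₁ : ℓ ^ e ∣ n₁
    · exact ZMod.exists_injective_prod_of_dvd hn₁ hn₂ h₁ hd₂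
    by_cases h₂ : ℓ ^ e ∣ n₂
    · exact AddEquiv.prodComm.exists_injective_addMonoidHom_congr.1
        (ZMod.exists_injective_prod_of_dvd hn₂ hn₁ h₂ hd₁)
    rw [key₁] at h₁
    rw [key₂] at h₂
    refine absurd (ZMod.exists_injective_prod_of_dvd hn₁ hn₂ ?_ ?_) hno
    · rw [key₁]
      omega
    · rw [key₂]
      omega
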